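/- Let C > 0, let X ⊆ ℝ^d, and let f: ℝ^d × ℝ^d → (0,1) be twice continuously differentiable in its first argument w such that the Hessian of log f is uniformly bounded by C on X, i.e., for every w ∈ ℝ^d, x ∈ X, y ∈ {0,1} and every unit vector u ∈ ℝ^d, |uᵀ ∇²_w log( f(w,x)^y (1−f(w,x))^{1−y} ) u| ≤ C. Let W ⊂ ℝ^d be compact, and H_f = { f(w,·) restricted to X : w ∈ W } with feature space X. Then r^a_T(H_f) ≤ log( Vol(W*) / Vol(B_2^d(√(d/(CT)))) ) + d/2 + log 2, where W* = { w + u : w ∈ W, ‖u‖₂ ≤ √(d/(CT)) } and Vol denotes Lebesgue measure on ℝ^d. -/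

import Mathlib

open Set MeasureTheory

/-- Logarithmic loss with values in `EReal`. -/
noncomputable def logLoss (p : ℝ) (y : Bool) : EReal :=
  if y then (if p = 0 then ⊤ else (((-Real.log p : ℝ)) : EReal))
  else (if p = 1 then ⊤ else (((-Real.log (1 - p) : ℝ)) : EReal))

noncomputable def lossSum (ps : List ℝ) (ys : List Bool) : EReal :=
  (List.zipWith logLoss ps ys).sum

noncomputable def expertLoss {X : Type*} (h : X → ℝ) (xs : List X) (ys : List Bool) : EReal :=
  (List.zipWith (fun x y => logLoss (h x) y) xs ys).sum

noncomputable def pointwiseRegret {X : Type*} (H : Set (X → ℝ))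
    (xs : List X) (ps : List ℝ) (ys : List Bool) : EReal :=
  lossSum ps ys - ⨅ h ∈ H, expertLoss h xs ys

noncomputable def seqRegretAux {X : Type*} (H : Set (X → ℝ)) :
    ℕ → List X → List ℝ → List Bool → EReal
  | 0, xs, ps, ys => pointwiseRegret H xs ps ys
  | n+1, xs, ps, ys =>
      ⨆ x : X, ⨅ p : Set.Icc (0:ℝ) 1, ⨆ y : Bool,
        seqRegretAux H n (xs ++ [x]) (ps ++ [(p : ℝ)]) (ys ++ [y])

/-- Sequential (agnostic) minimax regret `r^a_T(H)`. -/
noncomputable def seqRegret {X : Type*} (H : Set (X → ℝ)) (T : ℕ) : EReal :=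
  seqRegretAux H T [] [] []

/-- The probability that the Bernoulli predictions `h` assign to the labels along a list of
labelled examples. -/
noncomputable def likelihood {X : Type*} (h : X → ℝ) (l : List (X × Bool)) : ℝ :=
  (l.map fun z => if z.2 then h z.1 else 1 - h z.1).prod

@[simp] theorem likelihood_nil {X : Type*} (h : X → ℝ) : likelihood h [] = 1 := by
  simp [likelihood]

theorem likelihood_cons {X : Type*} (h : X → ℝ) (z : X × Bool) (l : List (X × Bool)) :
    likelihood h (z :: l) = (if z.2 then h z.1 else 1 - h z.1) * likelihood h l := by
  simp [likelihood]

theorem likelihood_concat {X : Type*} (h : X → ℝ) (l : List (X × Bool)) (z : X × Bool) :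
    likelihood h (l ++ [z]) = likelihood h l * (if z.2 then h z.1 else 1 - h z.1) := by
  simp [likelihood]

theorem likelihood_mem_Ioc {X : Type*} {h : X → ℝ} (hh : ∀ x, h x ∈ Ioo (0 : ℝ) 1)
    (l : List (X × Bool)) : likelihood h l ∈ Ioc (0 : ℝ) 1 := by
  induction l with
  | nil => simp
  | cons z l ih =>
    have hz : (if z.2 then h z.1 else 1 - h z.1) ∈ Ioc (0 : ℝ) 1 := by
      obtain ⟨h0, h1⟩ := hh z.1
      split_ifs <;> constructor <;> linarith
    rw [likelihood_cons]
    exact ⟨mul_pos hz.1 ih.1, mul_le_one₀ hz.2 ih.1.le ih.2⟩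

theorem logLoss_eq_coe {p : ℝ} (hp : p ∈ Ioo (0 : ℝ) 1) (y : Bool) :
    logLoss p y = ((-Real.log (if y then p else 1 - p) : ℝ) : EReal) := by
  cases y <;> simp [logLoss, hp.1.ne', hp.2.ne]

theorem expertLoss_eq_neg_log_likelihood {X : Type*} {h : X → ℝ}
    (hh : ∀ x, h x ∈ Ioo (0 : ℝ) 1) (xs : List X) (ys : List Bool) :
    expertLoss h xs ys = ((-Real.log (likelihood h (xs.zip ys)) : ℝ) : EReal) := by
  induction xs generalizing ys with
  | nil => simp [expertLoss]
  | cons x xs ih =>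
    cases ys with
    | nil => simp [expertLoss]
    | cons y ys =>
      have hy : (if y then h x else 1 - h x) ≠ 0 := by
        obtain ⟨h0, h1⟩ := hh x
        split_ifs <;> linarith
      have ih' := ih ys
      simp only [expertLoss] at ih' ⊢
      rw [List.zipWith_cons_cons, List.sum_cons, ih', logLoss_eq_coe (hh x), List.zip_cons_cons,
        likelihood_cons, Real.log_mul hy (likelihood_mem_Ioc hh _).1.ne', neg_add,
        EReal.coe_add]

theorem lossSum_concat {ps : List ℝ} {ys : List Bool} (hlen : ps.length = ys.length)
    (p : ℝ) (y : Bool) : lossSum (ps ++ [p]) (ys ++ [y]) = lossSum ps ys + logLoss p y := by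
  simp [lossSum, List.zipWith_append hlen]

section Mixture

variable {Ω X : Type*} [MeasurableSpace Ω] {μ : Measure Ω} {q : Ω → X → ℝ}

theorem measurable_likelihood (hq : ∀ x, Measurable fun ω => q ω x) (l : List (X × Bool)) :
    Measurable fun ω => likelihood (q ω) l := by
  induction l with
  | nil => simp
  | cons z l ih =>
    simp only [likelihood_cons]
    refine Measurable.mul ?_ ih
    split_ifs
    · exact hq z.1
    · exact (hq z.1).const_sub 1

theorem integrable_likelihood [IsFiniteMeasure μ] (hq : ∀ x, Measurable fun ω => q ω x)
    (hq01 : ∀ ω x, q ω x ∈ Ioo (0 : ℝ) 1) (l : List (X × Bool)) :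
    Integrable (fun ω => likelihood (q ω) l) μ := by
  refine Integrable.of_bound (measurable_likelihood hq l).aestronglyMeasurable 1 (.of_forall ?_)
  intro ω
  obtain ⟨h0, h1⟩ := likelihood_mem_Ioc (hq01 ω) l
  rwa [Real.norm_of_nonneg h0.le]

theorem integral_likelihood_pos [IsFiniteMeasure μ] [NeZero μ]
    (hq : ∀ x, Measurable fun ω => q ω x)
    (hq01 : ∀ ω x, q ω x ∈ Ioo (0 : ℝ) 1) (l : List (X × Bool)) :
    0 < ∫ ω, likelihood (q ω) l ∂μ := by
  have hpos := fun ω => (likelihood_mem_Ioc (hq01 ω) l).1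
  rw [integral_pos_iff_support_of_nonneg (fun ω => (hpos ω).le) (integrable_likelihood hq hq01 l)]
  have : Function.support (fun ω => likelihood (q ω) l) = univ :=
    eq_univ_of_forall fun ω => (hpos ω).ne'
  rw [this]
  exact Measure.measure_univ_pos.2 (NeZero.ne μ)

theorem integral_likelihood_concat_add [IsFiniteMeasure μ] (hq : ∀ x, Measurable fun ω => q ω x)
    (hq01 : ∀ ω x, q ω x ∈ Ioo (0 : ℝ) 1) (l : List (X × Bool)) (x : X) :
    ∫ ω, likelihood (q ω) (l ++ [(x, true)]) ∂μ + ∫ ω, likelihood (q ω) (l ++ [(x, false)]) ∂μ =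
      ∫ ω, likelihood (q ω) l ∂μ := by
  rw [← integral_add (integrable_likelihood hq hq01 _) (integrable_likelihood hq hq01 _)]
  refine integral_congr_ae (.of_forall fun ω => ?_)
  simp only [likelihood_concat, if_true, Bool.false_eq_true, if_false]
  ring

/-- The Bayesian mixture predictor bounds the minimax regret by the worst-case log-ratio between
the likelihood of an expert and the mixture likelihood. -/
theorem seqRegretAux_le_of_mixture [IsFiniteMeasure μ] [NeZero μ] {H : Set (X → ℝ)} {T : ℕ} {B : ℝ}
    (hq : ∀ x, Measurable fun ω => q ω x) (hq01 : ∀ ω x, q ω x ∈ Ioo (0 : ℝ) 1)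
    (hH : ∀ h ∈ H, ∀ x, h x ∈ Ioo (0 : ℝ) 1)
    (hB : ∀ h ∈ H, ∀ l : List (X × Bool), l.length = T →
      Real.log (likelihood h l) + Real.log (μ.real univ)
        - Real.log (∫ ω, likelihood (q ω) l ∂μ) ≤ B)
    (n : ℕ) (xs : List X) (ps : List ℝ) (ys : List Bool) (hxs : xs.length = ys.length)
    (hps : ps.length = ys.length) (hn : ys.length + n = T)
    (hloss : lossSum ps ys ≤ ((Real.log (μ.real univ)
      - Real.log (∫ ω, likelihood (q ω) (xs.zip ys) ∂μ) : ℝ) : EReal)) :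
    seqRegretAux H n xs ps ys ≤ (B : EReal) := by
  induction n generalizing xs ps ys with
  | zero =>
    set a := Real.log (μ.real univ) - Real.log (∫ ω, likelihood (q ω) (xs.zip ys) ∂μ) with ha
    have hinf : ((a - B : ℝ) : EReal) ≤ ⨅ h ∈ H, expertLoss h xs ys := by
      refine le_iInf₂ fun h hh => ?_
      rw [expertLoss_eq_neg_log_likelihood (hH h hh), EReal.coe_le_coe_iff]
      have := hB h hh (xs.zip ys) (by simp [hxs]; omega)
      linarith
    calc seqRegretAux H 0 xs ps ys = lossSum ps ys - ⨅ h ∈ H, expertLoss h xs ys := rfl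
      _ ≤ (a : EReal) - ((a - B : ℝ) : EReal) := EReal.sub_le_sub hloss hinf
      _ = (B : EReal) := by rw [← EReal.coe_sub, sub_sub_cancel]
  | succ n ih =>
    refine iSup_le fun x => ?_
    set M := fun l => ∫ ω, likelihood (q ω) l ∂μ with hM
    have hpos : ∀ l, 0 < M l := integral_likelihood_pos hq hq01
    have hadd : M (xs.zip ys ++ [(x, true)]) + M (xs.zip ys ++ [(x, false)]) = M (xs.zip ys) :=
      integral_likelihood_concat_add hq hq01 _ x
    have h0 := hpos (xs.zip ys)
    have h1 := hpos (xs.zip ys ++ [(x, true)])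
    have h2 := hpos (xs.zip ys ++ [(x, false)])
    set p := M (xs.zip ys ++ [(x, true)]) / M (xs.zip ys) with hp
    have hp01 : p ∈ Ioo (0 : ℝ) 1 := ⟨div_pos h1 h0, (div_lt_one h0).2 (by linarith)⟩
    refine (iInf_le _ ⟨p, Ioo_subset_Icc_self hp01⟩).trans (iSup_le fun y => ?_)
    have hy : (if y then p else 1 - p) = M (xs.zip ys ++ [(x, y)]) / M (xs.zip ys) := by
      cases y
      · simp only [Bool.false_eq_true, if_false, hp]
        rw [eq_div_iff h0.ne', sub_mul, div_mul_cancel₀ _ h0.ne']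
        linarith
      · simp [hp]
    refine ih _ _ _ (by simp [hxs]) (by simp [hps]) (by simp; omega) ?_
    rw [lossSum_concat hps, logLoss_eq_coe hp01, hy, List.zip_append hxs, List.zip_cons_cons,
      List.zip_nil_right, Real.log_div (hpos _).ne' h0.ne']
    refine (add_le_add_left hloss _).trans ?_
    rw [← EReal.coe_add, EReal.coe_le_coe_iff]
    simp only [hM]
    linarith

end Mixture

section Taylor

variable {E : Type*} [NormedAddCommGroup E] [NormedSpace ℝ E]

/-- A second-order lower Taylor bound for a `C²` function whose Hessian is bounded below. -/
theorem ContDiff.add_fderiv_sub_le_of_hessian_bound {g : E → ℝ} (hg : ContDiff ℝ 2 g) {C : ℝ}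
    (hC : ∀ w u : E, ‖u‖ = 1 → |iteratedFDeriv ℝ 2 g w ![u, u]| ≤ C) (w u : E) :
    g w + fderiv ℝ g w u - C / 2 * ‖u‖ ^ 2 ≤ g (w + u) := by
  have hd1 : Differentiable ℝ g := hg.differentiable (by norm_num)
  have hd2 : Differentiable ℝ (fderiv ℝ g) :=
    (hg.fderiv_right (m := 1) (by norm_num)).differentiable (by norm_num)
  have hbound : ∀ z, -(C * ‖u‖ ^ 2) ≤ fderiv ℝ (fderiv ℝ g) z u u := by
    intro z
    rcases eq_or_ne u 0 with rfl | hu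
    · simp
    have hn : ‖u‖ ≠ 0 := norm_ne_zero_iff.2 hu
    have h := (abs_le.1 (hC z (‖u‖⁻¹ • u) (by rw [norm_smul, norm_inv, norm_norm,
      inv_mul_cancel₀ hn]))).1
    rw [iteratedFDeriv_two_apply] at h
    simp only [Matrix.cons_val_zero, Matrix.cons_val_one, map_smul,
      smul_apply, smul_eq_mul] at h
    have h' := mul_le_mul_of_nonneg_right h (sq_nonneg ‖u‖)
    have e : ‖u‖⁻¹ * (‖u‖⁻¹ * fderiv ℝ (fderiv ℝ g) z u u) * ‖u‖ ^ 2 =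
        fderiv ℝ (fderiv ℝ g) z u u := by field_simp
    linarith
  have hline : ∀ t : ℝ, HasDerivAt (fun s : ℝ => w + s • u) u t := fun t => by
    simpa using ((hasDerivAt_id t).smul_const u).const_add w
  have hφ : ∀ t : ℝ, HasDerivAt (fun s : ℝ => g (w + s • u)) (fderiv ℝ g (w + t • u) u) t :=
    fun t => (hd1 _).hasFDerivAt.comp_hasDerivAt t (hline t)
  have hφ' : ∀ t : ℝ, HasDerivAt (fun s : ℝ => fderiv ℝ g (w + s • u) u)
      (fderiv ℝ (fderiv ℝ g) (w + t • u) u u) t := fun t => by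
    simpa using ((hd2 _).hasFDerivAt.comp_hasDerivAt t (hline t)).clm_apply
      (hasDerivAt_const t u)
  have hψ : ∀ t : ℝ, HasDerivAt (fun s : ℝ => g (w + s • u) + C / 2 * ‖u‖ ^ 2 * s ^ 2)
      (fderiv ℝ g (w + t • u) u + C * ‖u‖ ^ 2 * t) t := fun t => by
    refine ((hφ t).add (((hasDerivAt_id t).pow 2).const_mul (C / 2 * ‖u‖ ^ 2))).congr_deriv ?_
    simp only [id_eq, Nat.cast_ofNat, Nat.add_one_sub_one, pow_one, mul_one]
    ring
  have hψ' : ∀ t : ℝ, HasDerivAt (fun s : ℝ => fderiv ℝ g (w + s • u) u + C * ‖u‖ ^ 2 * s)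
      (fderiv ℝ (fderiv ℝ g) (w + t • u) u u + C * ‖u‖ ^ 2) t := fun t =>
    ((hφ' t).add ((hasDerivAt_id t).const_mul (C * ‖u‖ ^ 2))).congr_deriv (by simp)
  have hmono : Monotone fun s : ℝ => fderiv ℝ g (w + s • u) u + C * ‖u‖ ^ 2 * s :=
    monotone_of_hasDerivAt_nonneg hψ' fun t => by
      have := hbound (w + t • u)
      simp only [Pi.zero_apply]
      linarith
  have hconv : ConvexOn ℝ univ fun s : ℝ => g (w + s • u) + C / 2 * ‖u‖ ^ 2 * s ^ 2 := by
    refine Monotone.convexOn_univ_of_deriv (fun t => (hψ t).differentiableAt) ?_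
    rwa [funext fun t => (hψ t).deriv]
  have := hconv.le_slope_of_hasDerivAt (mem_univ 0) (mem_univ 1) one_pos (hψ 0)
  simp [slope_def_field] at this
  linarith

/-- Up to a log-linear factor, the likelihood decays at most like a Gaussian around any point. -/
theorem exists_likelihood_mul_exp_le {X : Type*} {q : E → X → ℝ} {C : ℝ}
    (hq01 : ∀ w x, q w x ∈ Ioo (0 : ℝ) 1) (hq : ∀ x, ContDiff ℝ 2 fun w => q w x)
    (hC : ∀ w x (y : Bool) (u : E), ‖u‖ = 1 → |iteratedFDeriv ℝ 2
      (fun w' => if y then Real.log (q w' x) else Real.log (1 - q w' x)) w ![u, u]| ≤ C)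
    (w : E) (l : List (X × Bool)) :
    ∃ D : E →L[ℝ] ℝ, ∀ u, likelihood (q w) l * Real.exp (D u - C * l.length / 2 * ‖u‖ ^ 2) ≤
      likelihood (q (w + u)) l := by
  induction l with
  | nil => exact ⟨0, fun u => by simp⟩
  | cons z l ih =>
    obtain ⟨D, hD⟩ := ih
    obtain ⟨x, y⟩ := z
    set g : E → ℝ := fun w' => if y then Real.log (q w' x) else Real.log (1 - q w' x) with hg
    have hexp : ∀ w', (if y then q w' x else 1 - q w' x) = Real.exp (g w') := fun w' => by
      obtain ⟨h0, h1⟩ := hq01 w' x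
      cases y
      · simp [hg, Real.exp_log (sub_pos.2 h1)]
      · simp [hg, Real.exp_log h0]
    have hsmooth : ContDiff ℝ 2 g := by
      cases y
      · simpa [hg] using (contDiff_const.sub (hq x)).log fun w' => (sub_pos.2 (hq01 w' x).2).ne'
      · simpa [hg] using (hq x).log fun w' => (hq01 w' x).1.ne'
    refine ⟨fderiv ℝ g w + D, fun u => ?_⟩
    have hT := hsmooth.add_fderiv_sub_le_of_hessian_bound (fun w' => hC w' x y) w u
    simp only [likelihood_cons, hexp]
    calc _ = Real.exp (g w + fderiv ℝ g w u - C / 2 * ‖u‖ ^ 2) *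
          (likelihood (q w) l * Real.exp (D u - C * l.length / 2 * ‖u‖ ^ 2)) := by
          rw [mul_right_comm, ← Real.exp_add, mul_left_comm, ← Real.exp_add, mul_comm]
          congr 2
          simp
          ring
      _ ≤ _ := mul_le_mul (Real.exp_le_exp.2 hT) (hD u)
          (mul_nonneg (likelihood_mem_Ioc (hq01 w) l).1.le (Real.exp_pos _).le) (Real.exp_pos _).le

end Taylor

section Volume

variable {E : Type*} [NormedAddCommGroup E] [NormedSpace ℝ E] [FiniteDimensional ℝ E]
  [MeasurableSpace E] [BorelSpace E] (μ : Measure E) [μ.IsAddHaarMeasure]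

theorem setIntegral_closedBall_clm_eq_zero (D : E →L[ℝ] ℝ) (r : ℝ) :
    ∫ u in Metric.closedBall (0 : E) r, D u ∂μ = 0 := by
  have h := (Measure.measurePreserving_neg μ).setIntegral_preimage_emb
    (MeasurableEquiv.neg E).measurableEmbedding (fun u => D u) (Metric.closedBall (0 : E) r)
  have hpre : Neg.neg ⁻¹' Metric.closedBall (0 : E) r = Metric.closedBall (0 : E) r := by
    ext; simp
  rw [hpre] at h
  simp only [map_neg, integral_neg] at h
  linarith

/-- Laplace-type lower bound on the mixture likelihood over a set containing a ball. -/
theorem likelihood_mul_measureReal_closedBall_le {X : Type*} {q : E → X → ℝ} {C r b : ℝ}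
    (hq01 : ∀ w x, q w x ∈ Ioo (0 : ℝ) 1) (hq : ∀ x, ContDiff ℝ 2 fun w => q w x)
    (hC : ∀ w x (y : Bool) (u : E), ‖u‖ = 1 → |iteratedFDeriv ℝ 2
      (fun w' => if y then Real.log (q w' x) else Real.log (1 - q w' x)) w ![u, u]| ≤ C)
    (hC0 : 0 ≤ C) (w : E) (l : List (X × Bool)) (hb : C * l.length / 2 * r ^ 2 ≤ b)
    {S : Set E} (hS : IsCompact S) (hball : Metric.closedBall w r ⊆ S) :
    likelihood (q w) l * Real.exp (-b) * μ.real (Metric.closedBall 0 r) ≤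
      ∫ v in S, likelihood (q v) l ∂μ := by
  obtain ⟨D, hD⟩ := exists_likelihood_mul_exp_le hq01 hq hC w l
  have hqm : ∀ x, Measurable fun v => q v x := fun x => (hq x).continuous.measurable
  have hint : ∀ {K : Set E}, IsCompact K →
      IntegrableOn (fun v => likelihood (q v) l) K μ := fun {K} hK => by
    have : IsFiniteMeasure (μ.restrict K) := ⟨by simpa using hK.measure_lt_top⟩
    exact integrable_likelihood hqm hq01 l
  have hpre : (fun u => w + u) ⁻¹' Metric.closedBall w r = Metric.closedBall 0 r := by
    ext; simp
  have hshift : ∫ u in Metric.closedBall (0 : E) r, likelihood (q (w + u)) l ∂μ =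
      ∫ v in Metric.closedBall w r, likelihood (q v) l ∂μ := by
    rw [← hpre]
    exact (measurePreserving_add_left μ w).setIntegral_preimage_emb
      (MeasurableEquiv.addLeft w).measurableEmbedding (fun v => likelihood (q v) l) _
  have hK : IsCompact (Metric.closedBall (0 : E) r) := isCompact_closedBall 0 r
  have hconst : IntegrableOn (fun _ : E => (1 : ℝ)) (Metric.closedBall 0 r) μ :=
    integrableOn_const hK.measure_lt_top.ne
  have hDint : IntegrableOn (fun u => D u) (Metric.closedBall 0 r) μ :=
    D.continuous.continuousOn.integrableOn_compact hK
  have hshift_int : IntegrableOn (fun u => likelihood (q (w + u)) l) (Metric.closedBall 0 r) μ := by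
    rw [← hpre]
    exact ((measurePreserving_add_left μ w).integrableOn_comp_preimage
      (MeasurableEquiv.addLeft w).measurableEmbedding).2 (hint (isCompact_closedBall w r))
  have hL := (likelihood_mem_Ioc (hq01 w) l).1
  calc likelihood (q w) l * Real.exp (-b) * μ.real (Metric.closedBall 0 r)
      = ∫ u in Metric.closedBall (0 : E) r, likelihood (q w) l * Real.exp (-b) * (1 + D u) ∂μ := by
        rw [integral_const_mul, integral_add hconst hDint, setIntegral_closedBall_clm_eq_zero]
        simp
    _ ≤ ∫ u in Metric.closedBall (0 : E) r, likelihood (q (w + u)) l ∂μ := by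
        refine setIntegral_mono_on ((hconst.add hDint).const_mul _) hshift_int
          measurableSet_closedBall fun u hu => ?_
        rw [mem_closedBall_zero_iff] at hu
        have hu' : C * l.length / 2 * ‖u‖ ^ 2 ≤ b := by
          refine le_trans ?_ hb
          gcongr
        refine le_trans ?_ (hD u)
        rw [mul_assoc]
        refine mul_le_mul_of_nonneg_left ?_ hL.le
        calc Real.exp (-b) * (1 + D u) ≤ Real.exp (-b) * Real.exp (D u) := by
              gcongr
              linarith [Real.add_one_le_exp (D u)]
          _ ≤ _ := by
              rw [← Real.exp_add]
              exact Real.exp_le_exp.2 (by linarith)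
    _ = ∫ v in Metric.closedBall w r, likelihood (q v) l ∂μ := hshift
    _ ≤ _ := setIntegral_mono_set (hint hS)
        (.of_forall fun v => (likelihood_mem_Ioc (hq01 v) l).1.le) hball.eventuallyLE

end Volume

/-- Theorem 4 (general form): if the Hessian in `w` of
`log (f(w,x)^y (1-f(w,x))^{1-y})` is uniformly bounded by `C` on the feature set
`Xs`, and `W` is compact, then
`r^a_T(H_f) ≤ log( Vol(W*) / Vol(B_2^d(√(d/(CT)))) ) + d/2 + log 2`,
where `W* = W + B_2^d(√(d/(CT)))`. -/
theorem seqRegret_boundedHessian_upper (d T : ℕ) (hd : 0 < d) (hT : 0 < T)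
    (C : ℝ) (hC : 0 < C)
    (Xs : Set (EuclideanSpace ℝ (Fin d)))
    (f : EuclideanSpace ℝ (Fin d) → EuclideanSpace ℝ (Fin d) → ℝ)
    (hrange : ∀ w x, f w x ∈ Set.Ioo (0:ℝ) 1)
    (hsmooth : ∀ x, ContDiff ℝ 2 (fun w => f w x))
    (hhess : ∀ (w : EuclideanSpace ℝ (Fin d)), ∀ x ∈ Xs, ∀ y : Bool,
      ∀ u : EuclideanSpace ℝ (Fin d), ‖u‖ = 1 →
        |iteratedFDeriv ℝ 2
            (fun w' => if y then Real.log (f w' x) else Real.log (1 - f w' x)) w ![u, u]| ≤ C)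
    (W : Set (EuclideanSpace ℝ (Fin d))) (hW : IsCompact W) :
    seqRegret {h : ↥Xs → ℝ | ∃ w ∈ W, h = fun x => f w x.1} T ≤
      ((Real.log
          ((volume {v : EuclideanSpace ℝ (Fin d) | ∃ w ∈ W,
              ∃ u ∈ Metric.closedBall (0 : EuclideanSpace ℝ (Fin d))
                (Real.sqrt ((d : ℝ) / (C * (T : ℝ)))), v = w + u}).toReal /
           (volume (Metric.closedBall (0 : EuclideanSpace ℝ (Fin d))
              (Real.sqrt ((d : ℝ) / (C * (T : ℝ)))))).toReal) +
        (d : ℝ) / 2 + Real.log 2 : ℝ) : EReal) := by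
  set r := Real.sqrt ((d : ℝ) / (C * (T : ℝ))) with hr
  set S : Set (EuclideanSpace ℝ (Fin d)) := {v | ∃ w ∈ W,
    ∃ u ∈ Metric.closedBall (0 : EuclideanSpace ℝ (Fin d)) r, v = w + u} with hS
  have hd' : (0 : ℝ) < d := Nat.cast_pos.2 hd
  have hT' : (0 : ℝ) < T := Nat.cast_pos.2 hT
  have hr0 : 0 < r := Real.sqrt_pos.2 (by positivity)
  have hlog2 : 0 ≤ Real.log 2 := Real.log_nonneg (by norm_num)
  set q : EuclideanSpace ℝ (Fin d) → Xs → ℝ := fun w x => f w x.1 with hq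
  have hq01 : ∀ w x, q w x ∈ Ioo (0 : ℝ) 1 := fun w x => hrange w x.1
  have hqsmooth : ∀ x, ContDiff ℝ 2 fun w => q w x := fun x => hsmooth x.1
  have hqm : ∀ x, Measurable fun w => q w x := fun x => (hqsmooth x).continuous.measurable
  have hH : ∀ h ∈ {h : ↥Xs → ℝ | ∃ w ∈ W, h = fun x => f w x.1}, ∀ x, h x ∈ Ioo (0 : ℝ) 1 := by
    rintro _ ⟨w, -, rfl⟩ x
    exact hrange w x.1
  rcases W.eq_empty_or_nonempty with hW0 | ⟨w₀, hw₀⟩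
  · refine seqRegretAux_le_of_mixture (μ := Measure.dirac 0) (T := T) hqm hq01 hH ?_ T [] [] []
      rfl rfl (by simp) (by simp [lossSum])
    rintro _ ⟨w, hw, -⟩
    simp [hW0] at hw
  have hSc : IsCompact S := by
    convert (hW.prod (isCompact_closedBall (0 : EuclideanSpace ℝ (Fin d)) r)).image continuous_add
    ext v
    simp only [hS, Set.mem_ofPred_eq, mem_image, Prod.exists, mem_prod]
    grind
  have hball : ∀ w ∈ W, Metric.closedBall w r ⊆ S := fun w hw v hv =>
    ⟨w, hw, v - w, by simpa [dist_eq_norm] using hv, by simp⟩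
  have hSfin : volume S ≠ ⊤ := hSc.measure_lt_top.ne
  have hSpos : 0 < volume S :=
    (Metric.measure_closedBall_pos volume w₀ hr0).trans_le (measure_mono (hball w₀ hw₀))
  have hSreal : 0 < volume.real S := ENNReal.toReal_pos hSpos.ne' hSfin
  have hBreal : 0 < volume.real (Metric.closedBall (0 : EuclideanSpace ℝ (Fin d)) r) :=
    ENNReal.toReal_pos (Metric.measure_closedBall_pos volume 0 hr0).ne'
      measure_closedBall_lt_top.ne
  have : IsFiniteMeasure (volume.restrict S) := ⟨by simpa using hSc.measure_lt_top⟩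
  have : NeZero (volume.restrict S) := ⟨fun h => hSpos.ne' (Measure.restrict_eq_zero.1 h)⟩
  refine seqRegretAux_le_of_mixture (μ := volume.restrict S) (T := T) hqm hq01 hH ?_ T [] [] []
    rfl rfl (by simp) (by simp [lossSum])
  rintro _ ⟨w, hw, rfl⟩ l hl
  have hb : C * l.length / 2 * r ^ 2 ≤ d / 2 := by
    rw [hl, hr, Real.sq_sqrt (by positivity)]
    refine le_of_eq ?_
    field_simp
  have hL := (likelihood_mem_Ioc (hq01 w) l).1
  have hmix := Real.log_le_log (by positivity) (likelihood_mul_measureReal_closedBall_le volume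
    hq01 hqsmooth (fun w x => hhess w x.1 x.2) hC.le w l hb hSc (hball w hw))
  rw [Real.log_mul (by positivity) hBreal.ne', Real.log_mul hL.ne' (Real.exp_pos _).ne',
    Real.log_exp] at hmix
  change _ ≤ Real.log (volume.real S / volume.real (Metric.closedBall 0 r)) + _ + _
  rw [Real.log_div hSreal.ne' hBreal.ne', measureReal_restrict_apply_univ]
  linarith
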